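/- (Restricted weak correlation property.) Fix truncation parameters τ_z ≥ 2, τ_h ≥ 1, τ_x ≥ 1, a sufficiently small constant ρ₃ > 0, and set τ_{h,z} = τ_z + (0.3τ_h(τ_z + 1.2τ_x) + τ_z²)^{1/2}. Let ε₀ > 0 satisfy ε₀ ≤ (1/2)·min{√(ρ₃/(3(τ_z⁴ + 5τ_z³ + 8τ_z² + 2τ_h²))), ρ₃/(15τ_z τ_{h,z}), 1/11}. For every ε ∈ (0,1) there exist constants c > 0 and C > 0 (depending only on the truncation parameters, ρ₃ and ε) such that the following holds. Let x ∈ ℝⁿ be nonzero, let a₁, …, a_m be independent standard Gaussian vectors in ℝⁿ, set ρ₄ = ρ₃ + 6τ_h τ_{h,z}² e^{−0.64τ_h²} + ε, and let ϑ_up be as in the restricted well conditioned property. If m ≥ C·n, then with probability at least 1 − e^{−c·m}, for all z ∈ ℝⁿ with ‖zz⊤ − xx⊤‖_F ≤ ε₀‖xx⊤‖_F one has (1/m)·‖P_{T_z}(A_z⊤(A_z((I − P_{T_z})(zz⊤ − xx⊤))))‖_F ≤ √(ρ₄ ϑ_up)·‖zz⊤ − xx⊤‖_F. -/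

import Mathlib

open Matrix MeasureTheory ProbabilityTheory

attribute [local instance] Classical.propDecidable

/-- Euclidean norm on `Fin n → ℝ`. -/
noncomputable def vecNorm {n : ℕ} (v : Fin n → ℝ) : ℝ := Real.sqrt (∑ i, (v i)^2)

/-- Euclidean inner product on `Fin n → ℝ`. -/
def dotp {n : ℕ} (v w : Fin n → ℝ) : ℝ := ∑ i, v i * w i

/-- Frobenius inner product. -/
def frobInner {n : ℕ} (A B : Matrix (Fin n) (Fin n) ℝ) : ℝ := ∑ i, ∑ j, A i j * B i j

/-- Frobenius norm. -/
noncomputable def frobNorm {n : ℕ} (A : Matrix (Fin n) (Fin n) ℝ) : ℝ :=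
  Real.sqrt (∑ i, ∑ j, (A i j)^2)

/-- The truncation event `E₁ᵏ(x) ∩ E₁ᵏ(z) ∩ E₂ᵏ(z)` for the `k`-th measurement. -/
def truncEvent {n m : ℕ} (a : Fin m → Fin n → ℝ) (x : Fin n → ℝ)
    (τx τz τh : ℝ) (z : Fin n → ℝ) (k : Fin m) : Prop :=
  (Real.sqrt ((dotp (a k) x)^2)
      ≤ τx * Real.sqrt ((∑ j, (dotp (a j) x)^2) / (m : ℝ))) ∧
  (|dotp (a k) z| ≤ τz * vecNorm z) ∧
  (|(dotp (a k) x)^2 - (dotp (a k) z)^2|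
      ≤ (τh / (m : ℝ)) * (∑ j, |(dotp (a j) x)^2 - (dotp (a j) z)^2|)
          * (|dotp (a k) z| + Real.sqrt ((dotp (a k) x)^2)) / vecNorm z)

/-- The truncated sensing operator `A_z`. -/
noncomputable def truncOp {n m : ℕ} (a : Fin m → Fin n → ℝ) (x : Fin n → ℝ)
    (τx τz τh : ℝ) (z : Fin n → ℝ) (W : Matrix (Fin n) (Fin n) ℝ) : Fin m → ℝ :=
  fun k => if truncEvent a x τx τz τh z k
    then frobInner (vecMulVec (a k) (a k)) W else 0

/-- The adjoint `A_zᵀ(b) = ∑ₖ bₖ aₖaₖᵀ · 1{E₁ᵏ(x) ∩ E₁ᵏ(z) ∩ E₂ᵏ(z)}`. -/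
noncomputable def truncAdj {n m : ℕ} (a : Fin m → Fin n → ℝ) (x : Fin n → ℝ)
    (τx τz τh : ℝ) (z : Fin n → ℝ) (b : Fin m → ℝ) : Matrix (Fin n) (Fin n) ℝ :=
  ∑ k, if truncEvent a x τx τz τh z k then b k • vecMulVec (a k) (a k) else 0

/-- The orthogonal projection of symmetric matrices onto the tangent space
`T_z = {z wᵀ + w zᵀ}`, `P(W) = QW + WQ − QWQ` with `Q = zzᵀ/‖z‖²`. -/
noncomputable def projT {n : ℕ} (z : Fin n → ℝ) (W : Matrix (Fin n) (Fin n) ℝ) :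
    Matrix (Fin n) (Fin n) ℝ :=
  ((vecNorm z ^ 2)⁻¹ • vecMulVec z z) * W + W * ((vecNorm z ^ 2)⁻¹ • vecMulVec z z)
    - ((vecNorm z ^ 2)⁻¹ • vecMulVec z z) * W * ((vecNorm z ^ 2)⁻¹ • vecMulVec z z)

/-- Standard Gaussian measure `N(0, Iₙ)` on `ℝⁿ`. -/
noncomputable def stdGaussianVec (n : ℕ) : Measure (Fin n → ℝ) :=
  Measure.pi fun _ => gaussianReal 0 1

/-- The distribution of `m` independent standard Gaussian vectors in `ℝⁿ`. -/
noncomputable def sampleMeasure (m n : ℕ) : Measure (Fin m → Fin n → ℝ) :=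
  Measure.pi fun _ => stdGaussianVec n

lemma rwc_card_le {E : Type*} [NormedAddCommGroup E] [NormedSpace ℝ E] [FiniteDimensional ℝ E]
    (d : ℝ) (hd : 0 < d) (s : Finset E) (hs : ∀ c ∈ s, ‖c‖ ≤ 1)
    (h : ∀ c ∈ s, ∀ e ∈ s, c ≠ e → d ≤ ‖c - e‖) :
    (s.card : ℝ) ≤ (1 + 2 / d) ^ Module.finrank ℝ E := by
  borelize E
  let μ : Measure E := Measure.addHaar
  let δ : ℝ := d / 2
  let ρ : ℝ := 1 + d / 2
  have δpos : 0 < δ := by positivity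
  have ρpos : 0 < ρ := by positivity
  set A := ⋃ c ∈ s, Metric.ball (c : E) δ with hA
  have D : Set.Pairwise (s : Set E) (Function.onFun Disjoint fun c => Metric.ball (c : E) δ) := by
    rintro c hc e he hce
    apply Metric.ball_disjoint_ball
    rw [dist_eq_norm]
    have := h c hc e he hce
    simp only [δ]; linarith
  have A_subset : A ⊆ Metric.ball (0 : E) ρ := by
    refine Set.iUnion₂_subset fun x hx => ?_
    apply Metric.ball_subset_ball'
    rw [dist_zero_right]
    have := hs x hx
    simp only [δ, ρ]; linarith
  have I :
    (s.card : ENNReal) * ENNReal.ofReal (δ ^ Module.finrank ℝ E) * μ (Metric.ball 0 1) ≤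
      ENNReal.ofReal (ρ ^ Module.finrank ℝ E) * μ (Metric.ball 0 1) :=
    calc
      (s.card : ENNReal) * ENNReal.ofReal (δ ^ Module.finrank ℝ E) * μ (Metric.ball 0 1) = μ A := by
        rw [hA, measure_biUnion_finset D fun c _ => measurableSet_ball]
        simp only [μ.addHaar_ball_of_pos _ δpos]
        simp only [Finset.sum_const, nsmul_eq_mul, mul_assoc]
      _ ≤ μ (Metric.ball (0 : E) ρ) := measure_mono A_subset
      _ = ENNReal.ofReal (ρ ^ Module.finrank ℝ E) * μ (Metric.ball 0 1) := by
        simp only [μ.addHaar_ball_of_pos _ ρpos]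
  have J : (s.card : ENNReal) * ENNReal.ofReal (δ ^ Module.finrank ℝ E) ≤
      ENNReal.ofReal (ρ ^ Module.finrank ℝ E) :=
    (ENNReal.mul_le_mul_iff_left (Metric.measure_ball_pos _ _ zero_lt_one).ne'
      measure_ball_lt_top.ne).1 I
  have K := ENNReal.toReal_le_of_le_ofReal (pow_nonneg ρpos.le _) J
  rw [ENNReal.toReal_mul, ENNReal.toReal_ofReal (by positivity), ENNReal.toReal_natCast] at K
  have e : (1 + 2 / d) = ρ / δ := by simp only [ρ, δ]; field_simp; ring
  rw [e, div_pow, le_div_iff₀ (by positivity)]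
  exact K

lemma rwc_net_E {E : Type*} [NormedAddCommGroup E] [NormedSpace ℝ E] [FiniteDimensional ℝ E]
    (d : ℝ) (hd : 0 < d) : ∃ s : Finset E, (s.card : ℝ) ≤ (1 + 2 / d) ^ Module.finrank ℝ E ∧
      (∀ c ∈ s, ‖c‖ ≤ 1) ∧ ∀ v : E, ‖v‖ ≤ 1 → ∃ c ∈ s, ‖v - c‖ ≤ d := by
  let S : Set ℕ := {k | ∃ s : Finset E, s.card = k ∧ (∀ c ∈ s, ‖c‖ ≤ 1) ∧
    ∀ c ∈ s, ∀ e ∈ s, c ≠ e → d ≤ ‖c - e‖}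
  have hne : S.Nonempty := ⟨0, ∅, by simp⟩
  have hb : BddAbove S := by
    refine ⟨⌊(1 + 2 / d) ^ Module.finrank ℝ E⌋₊, ?_⟩
    rintro k ⟨s, rfl, h1, h2⟩
    exact Nat.le_floor (rwc_card_le d hd s h1 h2)
  obtain ⟨s, hs, h1, h2⟩ := Nat.sSup_mem hne hb
  refine ⟨s, rwc_card_le d hd s h1 h2, h1, fun v hv => ?_⟩
  by_contra! hcon
  have hvs : v ∉ s := fun hmem => by
    have := hcon v hmem; simp at this; linarith
  have : (insert v s).card ∈ S := by
    refine ⟨insert v s, rfl, ?_, ?_⟩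
    · intro c hc
      rcases Finset.mem_insert.1 hc with rfl | hc
      · exact hv
      · exact h1 c hc
    · intro c hc e he hce
      rcases Finset.mem_insert.1 hc with hc' | hc' <;> rcases Finset.mem_insert.1 he with he' | he'
      · exact absurd (hc'.trans he'.symm) hce
      · rw [hc']; exact (hcon e he').le
      · rw [he', norm_sub_rev]; exact (hcon c hc').le
      · exact h2 c hc' e he' hce
  have := le_csSup hb this
  rw [Finset.card_insert_of_notMem hvs, ← hs] at this
  omega

lemma rwc_vecNorm_eq {n : ℕ} (v : Fin n → ℝ) : vecNorm v = ‖WithLp.toLp 2 v‖ := by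
  simp [vecNorm, EuclideanSpace.norm_eq]

lemma rwc_net (d : ℝ) (hd : 0 < d) (n : ℕ) : ∃ s : Finset (Fin n → ℝ),
    (s.card : ℝ) ≤ (1 + 2 / d) ^ n ∧
      (∀ c ∈ s, vecNorm c ≤ 1) ∧ ∀ v : Fin n → ℝ, vecNorm v ≤ 1 → ∃ c ∈ s, vecNorm (v - c) ≤ d := by
  obtain ⟨s, h1, h2, h3⟩ := rwc_net_E (E := EuclideanSpace ℝ (Fin n)) d hd
  refine ⟨s.image (fun c => WithLp.ofLp c), ?_, ?_, ?_⟩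
  · refine le_trans ?_ (h1.trans_eq (by simp))
    exact_mod_cast Finset.card_image_le
  · intro c hc
    obtain ⟨e, he, rfl⟩ := Finset.mem_image.1 hc
    rw [rwc_vecNorm_eq]; exact h2 e he
  · intro v hv
    obtain ⟨c, hc, hvc⟩ := h3 (WithLp.toLp 2 v) (by rwa [← rwc_vecNorm_eq])
    refine ⟨_, Finset.mem_image_of_mem _ hc, ?_⟩
    rw [rwc_vecNorm_eq]; exact hvc

lemma rwc_map_dotp {n : ℕ} (v : Fin n → ℝ) :
    (stdGaussianVec n).map (fun a => dotp a v) = gaussianReal 0 ((vecNorm v)^2).toNNReal := by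
  have h := IsGaussian.map_eq_gaussianReal (μ := stdGaussian (EuclideanSpace ℝ (Fin n)))
    (innerSL ℝ (WithLp.toLp 2 v))
  rw [variance_dual_stdGaussian, integral_strongDual_stdGaussian, innerSL_apply_norm,
    ← rwc_vecNorm_eq, ← map_pi_eq_stdGaussian, Measure.map_map (by fun_prop) (by fun_prop)] at h
  rw [← h]
  unfold stdGaussianVec
  congr 1

lemma rwc_gauss_exp : ∫⁻ t, ENNReal.ofReal (Real.exp (3/8 * t^2)) ∂(gaussianReal 0 1) ≤ 2 := by
  rw [gaussianReal_of_var_ne_zero _ one_ne_zero,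
    lintegral_withDensity_eq_lintegral_mul _ (by fun_prop) (by fun_prop)]
  have e : ∀ t : ℝ, (gaussianPDF 0 1 * fun t => ENNReal.ofReal (Real.exp (3/8 * t^2))) t =
      ENNReal.ofReal ((√(2 * Real.pi))⁻¹ * Real.exp (-(1/8) * t^2)) := by
    intro t
    simp only [Pi.mul_apply, gaussianPDF, gaussianPDFReal]
    rw [← ENNReal.ofReal_mul (by positivity), mul_assoc, ← Real.exp_add]
    congr 2
    · simp
    · congr 1; simp; ring
  simp_rw [e]
  rw [← ofReal_integral_eq_lintegral_ofReal
    ((integrable_exp_neg_mul_sq (by norm_num)).const_mul _)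
    (Filter.Eventually.of_forall fun t => by positivity), integral_const_mul, integral_gaussian]
  have : Real.pi / (1/8) = 2^2 * (2 * Real.pi) := by ring
  rw [this, Real.sqrt_mul (by positivity) (2 * Real.pi), Real.sqrt_sq (by norm_num)]
  have hp : √(2 * Real.pi) ≠ 0 := by positivity
  have : (√(2 * Real.pi))⁻¹ * (2 * √(2 * Real.pi)) = 2 := by field_simp
  rw [this]; simp

lemma rwc_gauss_exp_vec {n : ℕ} (v : Fin n → ℝ) (hv : vecNorm v ≤ 1) :
    ∫⁻ a, ENNReal.ofReal (Real.exp (3/8 * (dotp a v)^2)) ∂(stdGaussianVec n) ≤ 2 := by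
  have hm : Measurable (fun a : Fin n → ℝ => dotp a v) := by unfold dotp; fun_prop
  have h1 := lintegral_map (μ := stdGaussianVec n)
    (f := fun t : ℝ => ENNReal.ofReal (Real.exp (3/8 * t^2))) (by fun_prop) hm
  rw [← h1, rwc_map_dotp]
  have h2 := gaussianReal_map_const_mul (μ := 0) (v := 1) (vecNorm v)
  have h0 : 0 ≤ vecNorm v := Real.sqrt_nonneg _
  have h3 : gaussianReal 0 ((vecNorm v)^2).toNNReal = (gaussianReal 0 1).map (vecNorm v * ·) := by
    rw [h2]; congr 1
    · simp
    · ext; simp [Real.toNNReal_of_nonneg, sq_nonneg]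
  rw [h3, lintegral_map (by fun_prop) (by fun_prop)]
  refine le_trans (lintegral_mono fun t => ?_) rwc_gauss_exp
  apply ENNReal.ofReal_le_ofReal
  apply Real.exp_le_exp.2
  have : vecNorm v ^ 2 ≤ 1 := by nlinarith
  nlinarith [sq_nonneg t]

instance rwc_prob_vec (n : ℕ) : IsProbabilityMeasure (stdGaussianVec n) := by
  unfold stdGaussianVec; infer_instance

instance rwc_prob_sample (m n : ℕ) : IsProbabilityMeasure (sampleMeasure m n) := by
  unfold sampleMeasure; infer_instance

/-- Chernoff bound. -/
lemma rwc_chernoff {n : ℕ} (m : ℕ) (g : (Fin n → ℝ) → ℝ) (hg : Measurable g) (B T : ℝ)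
    (hB : ∫⁻ a, ENNReal.ofReal (Real.exp (g a)) ∂(stdGaussianVec n) ≤ ENNReal.ofReal (Real.exp B)) :
    sampleMeasure m n {a | (m : ℝ) * T ≤ ∑ k, g (a k)} ≤
      ENNReal.ofReal (Real.exp (-((T - B) * m))) := by
  have hind : iIndepFun (fun (k : Fin m) (a : Fin m → Fin n → ℝ) =>
      ENNReal.ofReal (Real.exp (g (a k)))) (sampleMeasure m n) := by
    unfold sampleMeasure
    exact iIndepFun_pi (X := fun (_ : Fin m) (a : Fin n → ℝ) => ENNReal.ofReal (Real.exp (g a)))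
      (fun _ => by fun_prop)
  have h1 := lintegral_prod_eq_prod_lintegral_of_indepFun Finset.univ _ hind (fun k => by fun_prop)
  have h2 : ∀ k : Fin m, ∫⁻ a, ENNReal.ofReal (Real.exp (g (a k))) ∂(sampleMeasure m n) =
      ∫⁻ a, ENNReal.ofReal (Real.exp (g a)) ∂(stdGaussianVec n) := by
    intro k
    have := (measurePreserving_eval (fun _ : Fin m => stdGaussianVec n) k).lintegral_comp
      (f := fun a => ENNReal.ofReal (Real.exp (g a))) (by fun_prop)
    exact this
  simp_rw [h2, Finset.prod_const, Finset.card_univ, Fintype.card_fin] at h1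
  have h3 : ∀ a : Fin m → Fin n → ℝ, ∏ k, ENNReal.ofReal (Real.exp (g (a k))) =
      ENNReal.ofReal (Real.exp (∑ k, g (a k))) := by
    intro a
    rw [Real.exp_sum, ENNReal.ofReal_prod_of_nonneg (fun _ _ => by positivity)]
  simp_rw [h3] at h1
  have h4 := mul_meas_ge_le_lintegral (μ := sampleMeasure m n)
    (f := fun a => ENNReal.ofReal (Real.exp (∑ k, g (a k)))) (by fun_prop)
    (ENNReal.ofReal (Real.exp (m * T)))
  rw [h1] at h4
  have h5 : sampleMeasure m n {a | (m : ℝ) * T ≤ ∑ k, g (a k)} ≤ sampleMeasure m n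
      {a | ENNReal.ofReal (Real.exp (m * T)) ≤ ENNReal.ofReal (Real.exp (∑ k, g (a k)))} :=
    measure_mono fun a ha => ENNReal.ofReal_le_ofReal (Real.exp_le_exp.2 ha)
  have h6 : ENNReal.ofReal (Real.exp (m * T)) * sampleMeasure m n {a | (m : ℝ) * T ≤ ∑ k, g (a k)}
      ≤ ENNReal.ofReal (Real.exp (m * B)) := by
    refine (mul_le_mul_right h5 _).trans (h4.trans ?_)
    refine (pow_le_pow_left' hB m).trans_eq ?_
    rw [← ENNReal.ofReal_pow (by positivity), ← Real.exp_nat_mul]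
  have h7 : ENNReal.ofReal (Real.exp (-((T - B) * m))) =
      ENNReal.ofReal (Real.exp (m * B)) / ENNReal.ofReal (Real.exp (m * T)) := by
    rw [← ENNReal.ofReal_div_of_pos (by positivity), ← Real.exp_sub]
    congr 2; ring
  rw [h7, ENNReal.le_div_iff_mul_le (by simp [Real.exp_pos]) (by simp), mul_comm]
  exact h6

noncomputable def rwcPhi (R t : ℝ) : ℝ := t^2 * min (t^2 / R^2) 1

noncomputable def rwcPsi (R t : ℝ) : ℝ := |t| * min (|t| / R) 1

lemma rwc_phi_eq (R t : ℝ) (hR : 0 < R) : rwcPhi R t = rwcPsi R t ^ 2 := by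
  unfold rwcPhi rwcPsi
  rw [mul_pow, sq_abs]
  rcases le_total (|t|/R) 1 with h | h
  · have h0 : 0 ≤ |t|/R := by positivity
    have h2 : t^2/R^2 ≤ 1 := by
      rw [← sq_abs t, ← div_pow]; nlinarith
    rw [min_eq_left h, min_eq_left h2, div_pow, sq_abs]
  · have h2 : 1 ≤ t^2/R^2 := by
      rw [← sq_abs t, ← div_pow]; nlinarith
    rw [min_eq_right h, min_eq_right h2]; norm_num

lemma rwc_psi_nonneg (R t : ℝ) (hR : 0 < R) : 0 ≤ rwcPsi R t := by
  unfold rwcPsi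
  have : 0 ≤ min (|t| / R) 1 := le_min (by positivity) zero_le_one
  positivity

lemma rwc_psi_aux (R p q : ℝ) (hR : 0 < R) (hp : 0 ≤ p) (hq : 0 ≤ q) :
    (p + q) * min ((p + q) / R) 1 ≤ p * min (p / R) 1 + 2 * q := by
  rcases le_total ((p+q)/R) 1 with h | h
  · have h' : p / R ≤ 1 := le_trans (by gcongr; linarith) h
    rw [min_eq_left h, min_eq_left h']
    have e : (p + q) * ((p + q)/R) = p * (p/R) + q * (p / R) + q * ((p+q)/R) := by ring
    rw [e]; nlinarith
  · rw [min_eq_right h]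
    rcases le_total (p/R) 1 with h' | h'
    · rw [min_eq_left h']
      have h1 : R ≤ p + q := by rwa [le_div_iff₀ hR, one_mul] at h
      have h2 : p ≤ R := by rwa [div_le_iff₀ hR, one_mul] at h'
      have h3 : p - p * (p/R) ≤ q := by
        have : p - p * (p/R) = (p/R) * (R - p) := by field_simp
        rw [this]; nlinarith
      linarith
    · rw [min_eq_right h']; linarith

lemma rwc_psi_mono (R p q : ℝ) (hR : 0 < R) (hp : 0 ≤ p) (hq : p ≤ q) :
    p * min (p / R) 1 ≤ q * min (q / R) 1 := by
  have : min (p/R) 1 ≤ min (q/R) 1 := by gcongr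
  have h0 : 0 ≤ min (p / R) 1 := le_min (by positivity) zero_le_one
  exact mul_le_mul hq this h0 (by linarith)

lemma rwc_phi_add (R s t : ℝ) (hR : 0 < R) :
    rwcPhi R t ≤ (6/5) * rwcPhi R s + 24 * (t - s)^2 := by
  rw [rwc_phi_eq R _ hR, rwc_phi_eq R _ hR]
  have h1 : rwcPsi R t ≤ rwcPsi R s + 2 * |t - s| := by
    have h := rwc_psi_aux R |s| |t - s| hR (abs_nonneg _) (abs_nonneg _)
    refine le_trans (rwc_psi_mono R |t| (|s| + |t-s|) hR (abs_nonneg _) ?_) h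
    have := abs_add_le s (t - s)
    simpa using this
  have h0 := rwc_psi_nonneg R t hR
  have h2 : rwcPsi R t ^ 2 ≤ (rwcPsi R s + 2 * |t - s|)^2 := by gcongr
  have h3 : |t - s|^2 = (t-s)^2 := sq_abs _
  nlinarith [sq_nonneg (rwcPsi R s - 10 * |t - s|)]

lemma rwc_exp_pt (R t : ℝ) (hR : 0 < R) :
    Real.exp (rwcPhi R t / 8) ≤ 1 + 9 / (8 * R^2) * Real.exp (3/8 * t^2) := by
  have hmin0 : 0 ≤ min (t^2/R^2) 1 := le_min (by positivity) zero_le_one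
  have hp0 : 0 ≤ rwcPhi R t := by unfold rwcPhi; positivity
  have hp1 : rwcPhi R t ≤ t^2 := by
    unfold rwcPhi
    nlinarith [min_le_right (t^2/R^2) 1, sq_nonneg t]
  have hp2 : rwcPhi R t ≤ t^4 / R^2 := by
    unfold rwcPhi
    have : t^4/R^2 = t^2 * (t^2/R^2) := by ring
    rw [this]; gcongr; exact min_le_left _ _
  have h1 : Real.exp (rwcPhi R t / 8) ≤ 1 + rwcPhi R t / 8 * Real.exp (rwcPhi R t / 8) := by
    have h := Real.add_one_le_exp (-(rwcPhi R t / 8))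
    have hpos := Real.exp_pos (rwcPhi R t / 8)
    have : Real.exp (-(rwcPhi R t / 8)) * Real.exp (rwcPhi R t / 8) = 1 := by
      rw [← Real.exp_add]; simp
    nlinarith
  have h2 : t^4 ≤ 9 * Real.exp (t^2/4) := by
    have h := Real.add_one_le_exp (t^2/8 - 1)
    have hs : Real.exp (t^2/4) = (Real.exp (t^2/8 - 1))^2 * (Real.exp 1)^2 := by
      rw [← Real.exp_nat_mul, ← Real.exp_nat_mul, ← Real.exp_add]; congr 1; push_cast; ring
    have he := Real.exp_one_gt_d9
    have h3 : (t^2/8)^2 ≤ (Real.exp (t^2/8 - 1))^2 := by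
      apply pow_le_pow_left₀ (by positivity); linarith
    have h4 : (64/9 : ℝ) ≤ Real.exp 1 ^ 2 := by nlinarith
    rw [hs]
    have h5 : 0 ≤ (Real.exp (t^2/8 - 1))^2 := by positivity
    nlinarith
  calc Real.exp (rwcPhi R t / 8) ≤ 1 + rwcPhi R t / 8 * Real.exp (rwcPhi R t / 8) := h1
    _ ≤ 1 + (t^4 / R^2) / 8 * Real.exp (t^2 / 8) := by gcongr
    _ ≤ 1 + (9 * Real.exp (t^2/4) / R^2) / 8 * Real.exp (t^2 / 8) := by gcongr
    _ = 1 + 9 / (8 * R^2) * (Real.exp (t^2/4) * Real.exp (t^2/8)) := by field_simp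
    _ = _ := by rw [← Real.exp_add]; congr 3; ring

lemma rwc_exp_phi {n : ℕ} (R : ℝ) (hR : 0 < R) (v : Fin n → ℝ) (hv : vecNorm v ≤ 1) :
    ∫⁻ a, ENNReal.ofReal (Real.exp (rwcPhi R (dotp a v) / 8)) ∂(stdGaussianVec n) ≤
      ENNReal.ofReal (Real.exp (9 / (4 * R^2))) := by
  have hm : Measurable (fun a : Fin n → ℝ => dotp a v) := by unfold dotp; fun_prop
  calc _ ≤ ∫⁻ a, (1 + ENNReal.ofReal (9 / (8 * R^2)) *
        ENNReal.ofReal (Real.exp (3/8 * (dotp a v)^2))) ∂(stdGaussianVec n) := by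
        refine lintegral_mono fun a => ?_
        refine (ENNReal.ofReal_le_ofReal (rwc_exp_pt R _ hR)).trans_eq ?_
        rw [ENNReal.ofReal_add (by norm_num) (by positivity), ENNReal.ofReal_mul (by positivity)]
        simp
    _ = 1 + ENNReal.ofReal (9 / (8 * R^2)) *
        ∫⁻ a, ENNReal.ofReal (Real.exp (3/8 * (dotp a v)^2)) ∂(stdGaussianVec n) := by
        rw [lintegral_add_left (by fun_prop), lintegral_const_mul _ (by fun_prop)]
        simp
    _ ≤ 1 + ENNReal.ofReal (9 / (8 * R^2)) * 2 := by
        gcongr; exact rwc_gauss_exp_vec v hv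
    _ = ENNReal.ofReal (1 + 9 / (4 * R^2)) := by
        rw [ENNReal.ofReal_add (by norm_num) (by positivity)]
        have : 9 / (4 * R^2) = 9 / (8 * R^2) * 2 := by field_simp; norm_num
        rw [this, ENNReal.ofReal_mul (by positivity)]; simp
    _ ≤ _ := by
        apply ENNReal.ofReal_le_ofReal
        have := Real.add_one_le_exp (9 / (4 * R^2)); linarith

lemma rwc_dotp_sub {n : ℕ} (a v w : Fin n → ℝ) : dotp a (v - w) = dotp a v - dotp a w := by
  simp [dotp, mul_sub, Finset.sum_sub_distrib]

lemma rwc_dotp_smul {n : ℕ} (a v : Fin n → ℝ) (r : ℝ) : dotp a (r • v) = r * dotp a v := by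
  simp only [dotp, Pi.smul_apply, smul_eq_mul, Finset.mul_sum]
  exact Finset.sum_congr rfl fun i _ => by ring

lemma rwc_vecNorm_smul {n : ℕ} (v : Fin n → ℝ) (r : ℝ) : vecNorm (r • v) = |r| * vecNorm v := by
  rw [rwc_vecNorm_eq, rwc_vecNorm_eq, WithLp.toLp_smul, norm_smul, Real.norm_eq_abs]

lemma rwc_vecNorm_eq_zero {n : ℕ} (v : Fin n → ℝ) : vecNorm v = 0 ↔ v = 0 := by
  rw [rwc_vecNorm_eq, norm_eq_zero, WithLp.toLp_eq_zero]

lemma rwc_vecNorm_nonneg {n : ℕ} (v : Fin n → ℝ) : 0 ≤ vecNorm v := Real.sqrt_nonneg _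

lemma rwc_opnorm {n m : ℕ} (a : Fin m → Fin n → ℝ) (d : ℝ) (hd : d^2 ≤ 1/150)
    (s : Finset (Fin n → ℝ))
    (hnet : ∀ v : Fin n → ℝ, vecNorm v ≤ 1 → ∃ c ∈ s, vecNorm (v - c) ≤ d)
    (hs : ∀ c ∈ s, ∑ k, (dotp (a k) c)^2 ≤ 2 * m) (v : Fin n → ℝ) :
    ∑ k, (dotp (a k) v)^2 ≤ 5/2 * m * (vecNorm v)^2 := by
  let F : EuclideanSpace ℝ (Fin n) → ℝ := fun w => ∑ k, (dotp (a k) w.ofLp)^2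
  have hF : Continuous F := by simp only [F, dotp]; fun_prop
  obtain ⟨w, hw, hmax⟩ := (isCompact_closedBall (0 : EuclideanSpace ℝ (Fin n)) 1).exists_isMaxOn
    ⟨0, by simp⟩ hF.continuousOn
  have hw' : vecNorm w.ofLp ≤ 1 := by rw [rwc_vecNorm_eq]; simpa using hw
  have hmax' : ∀ u : Fin n → ℝ, vecNorm u ≤ 1 → ∑ k, (dotp (a k) u)^2 ≤ F w := by
    intro u hu
    exact hmax (a := WithLp.toLp 2 u) (by simpa [← rwc_vecNorm_eq] using hu)
  have hF0 : 0 ≤ F w := Finset.sum_nonneg fun k _ => sq_nonneg _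
  have hhom : ∀ u : Fin n → ℝ, ∑ k, (dotp (a k) u)^2 ≤ F w * (vecNorm u)^2 := by
    intro u
    by_cases hu : u = 0
    · subst hu; simp [dotp]; positivity
    have hpos : 0 < vecNorm u := lt_of_le_of_ne (rwc_vecNorm_nonneg u)
      (Ne.symm ((rwc_vecNorm_eq_zero u).not.2 hu))
    have h := hmax' ((vecNorm u)⁻¹ • u) (by
      rw [rwc_vecNorm_smul, abs_of_pos (inv_pos.2 hpos), inv_mul_cancel₀ hpos.ne'])
    simp_rw [rwc_dotp_smul, mul_pow, ← Finset.mul_sum] at h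
    rw [inv_pow, inv_mul_le_iff₀ (by positivity)] at h
    linarith
  obtain ⟨c, hc, hwc⟩ := hnet _ hw'
  have h1 : F w ≤ (6/5) * ∑ k, (dotp (a k) c)^2 + 6 * ∑ k, (dotp (a k) (w.ofLp - c))^2 := by
    rw [Finset.mul_sum, Finset.mul_sum, ← Finset.sum_add_distrib]
    refine Finset.sum_le_sum fun k _ => ?_
    rw [rwc_dotp_sub]
    nlinarith [sq_nonneg (dotp (a k) c - 5 * (dotp (a k) w.ofLp - dotp (a k) c))]
  have h2 := hs c hc
  have h3 := hhom (w.ofLp - c)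
  have h4 : vecNorm (w.ofLp - c) ^ 2 ≤ 1/150 := by
    refine le_trans ?_ hd
    have := rwc_vecNorm_nonneg (w.ofLp - c); gcongr
  have h5 : F w ≤ 5/2 * m := by nlinarith
  exact (hhom v).trans (by gcongr)

lemma rwc_unif {n m : ℕ} (a : Fin m → Fin n → ℝ) (R d : ℝ) (hR : 0 < R)
    (hd : d^2 ≤ 1/(60 * R^2))
    (s : Finset (Fin n → ℝ))
    (hnet : ∀ v : Fin n → ℝ, vecNorm v ≤ 1 → ∃ c ∈ s, vecNorm (v - c) ≤ d)
    (hop : ∀ v, ∑ k, (dotp (a k) v)^2 ≤ 5/2 * m * (vecNorm v)^2)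
    (hs : ∀ c ∈ s, ∑ k, rwcPhi R (dotp (a k) c) ≤ 20 / R^2 * m) (v : Fin n → ℝ)
    (hv : vecNorm v ≤ 1) :
    ∑ k, rwcPhi R (dotp (a k) v) ≤ 25 / R^2 * m := by
  obtain ⟨c, hc, hvc⟩ := hnet v hv
  have h1 : ∑ k, rwcPhi R (dotp (a k) v) ≤
      (6/5) * ∑ k, rwcPhi R (dotp (a k) c) + 24 * ∑ k, (dotp (a k) (v - c))^2 := by
    rw [Finset.mul_sum, Finset.mul_sum, ← Finset.sum_add_distrib]
    refine Finset.sum_le_sum fun k _ => ?_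
    rw [rwc_dotp_sub]
    exact rwc_phi_add R _ _ hR
  have h2 := hs c hc
  have h3 := hop (v - c)
  have h4 : vecNorm (v - c) ^ 2 ≤ 1/(60*R^2) := by
    refine le_trans ?_ hd
    have := rwc_vecNorm_nonneg (v - c); gcongr
  have h5 : 5/2 * (m:ℝ) * (vecNorm (v - c))^2 ≤ 5/2 * m * (1/(60*R^2)) := by gcongr
  have e1 : 25/R^2 * (m:ℝ) = (6/5) * (20/R^2*m) + 24 * (5/2 * m * (1/(60*R^2))) := by
    field_simp; ring
  rw [e1]; linarith

lemma rwc_event (R : ℝ) (hR : 3 ≤ R) : ∃ c C : ℝ, 0 < c ∧ 0 < C ∧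
    ∀ n m : ℕ, 1 ≤ n → C * (n:ℝ) ≤ m →
    ENNReal.ofReal (1 - Real.exp (-(c * (m:ℝ)))) ≤ sampleMeasure m n
      {a | (∀ v, ∑ k, (dotp (a k) v)^2 ≤ 5/2 * m * (vecNorm v)^2) ∧
        ∀ v, vecNorm v ≤ 1 → ∑ k, rwcPhi R (dotp (a k) v) ≤ 25 / R^2 * m} := by
  have hR0 : 0 < R := by linarith
  set d : ℝ := 1 / (13 * R) with hd
  have hd0 : 0 < d := by positivity
  have hd1 : d^2 ≤ 1/150 := by
    rw [hd, div_pow]; apply div_le_div₀ <;> nlinarith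
  have hd2 : d^2 ≤ 1/(60*R^2) := by
    rw [hd, div_pow, mul_pow, one_pow]; gcongr; norm_num
  set M : ℝ := 2 * (1 + 2/d) with hM
  have hM1 : 1 < M := by rw [hM]; have : 0 < 2/d := by positivity
                         linarith
  have hlog : 0 < Real.log M := Real.log_pos hM1
  set b : ℝ := 1 / (4 * R^2) with hb
  have hb0 : 0 < b := by positivity
  have hb1 : b ≤ 1/20 := by rw [hb]; gcongr; nlinarith
  refine ⟨b/2, 2 * Real.log M / b, by positivity, by positivity, ?_⟩
  intro n m hn hm
  obtain ⟨s, hcard, hs1, hnet⟩ := rwc_net d hd0 n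
  set G := {a : Fin m → Fin n → ℝ | (∀ v, ∑ k, (dotp (a k) v)^2 ≤ 5/2 * m * (vecNorm v)^2) ∧
        ∀ v, vecNorm v ≤ 1 → ∑ k, rwcPhi R (dotp (a k) v) ≤ 25 / R^2 * m} with hG
  let B1 : (Fin n → ℝ) → Set (Fin m → Fin n → ℝ) := fun c =>
    {a | (m:ℝ) * (3/4) ≤ ∑ k, 3/8 * (dotp (a k) c)^2}
  let B2 : (Fin n → ℝ) → Set (Fin m → Fin n → ℝ) := fun c =>
    {a | (m:ℝ) * (5/(2*R^2)) ≤ ∑ k, rwcPhi R (dotp (a k) c) / 8}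
  have hsub : Gᶜ ⊆ ⋃ c ∈ s, (B1 c ∪ B2 c) := by
    intro a ha
    by_contra hcon
    simp only [Set.mem_iUnion, not_exists, Set.mem_union, not_or, B1, B2, Set.mem_ofPred_eq,
      not_le] at hcon
    apply ha
    have hA : ∀ c ∈ s, ∑ k, (dotp (a k) c)^2 ≤ 2 * m := by
      intro c hc
      have := (hcon c hc).1
      rw [← Finset.mul_sum] at this; linarith
    have hop := rwc_opnorm a d hd1 s hnet hA
    refine ⟨hop, rwc_unif a R d hR0 hd2 s hnet hop ?_⟩
    intro c hc
    have := (hcon c hc).2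
    rw [← Finset.sum_div] at this
    have e : 20 / R^2 * (m:ℝ) = 8 * (m * (5/(2*R^2))) := by field_simp; ring
    rw [e]; linarith
  have hmeas : ∀ c : Fin n → ℝ, Measurable (fun a : Fin n → ℝ => dotp a c) := by
    intro c; unfold dotp; fun_prop
  have hP1 : ∀ c ∈ s, sampleMeasure m n (B1 c) ≤ ENNReal.ofReal (Real.exp (-(b * m))) := by
    intro c hc
    have hmc := hmeas c
    refine (rwc_chernoff m (fun a => 3/8 * (dotp a c)^2) (by fun_prop) (7/10) (3/4) ?_).trans ?_
    · refine (rwc_gauss_exp_vec c (hs1 c hc)).trans ?_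
      rw [show (2:ENNReal) = ENNReal.ofReal 2 by simp]
      apply ENNReal.ofReal_le_ofReal
      rw [← Real.log_le_iff_le_exp (by norm_num)]
      have := Real.log_two_lt_d9; linarith
    · apply ENNReal.ofReal_le_ofReal
      apply Real.exp_le_exp.2
      have : b * (m:ℝ) ≤ 1/20 * m := by gcongr
      linarith
  have hP2 : ∀ c ∈ s, sampleMeasure m n (B2 c) ≤ ENNReal.ofReal (Real.exp (-(b * m))) := by
    intro c hc
    have hmc := hmeas c
    refine (rwc_chernoff m (fun a => rwcPhi R (dotp a c) / 8) (by unfold rwcPhi; fun_prop)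
      (9/(4*R^2)) (5/(2*R^2)) (rwc_exp_phi R hR0 c (hs1 c hc))).trans_eq ?_
    congr 4
    rw [hb]; field_simp; norm_num
  have hbad : sampleMeasure m n Gᶜ ≤ ENNReal.ofReal (Real.exp (-(b/2 * m))) := by
    calc sampleMeasure m n Gᶜ ≤ sampleMeasure m n (⋃ c ∈ s, (B1 c ∪ B2 c)) := measure_mono hsub
      _ ≤ ∑ c ∈ s, sampleMeasure m n (B1 c ∪ B2 c) := measure_biUnion_finset_le _ _
      _ ≤ ∑ c ∈ s, (ENNReal.ofReal (Real.exp (-(b * m))) + ENNReal.ofReal (Real.exp (-(b * m)))) :=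
        Finset.sum_le_sum fun c hc => (measure_union_le _ _).trans
          (add_le_add (hP1 c hc) (hP2 c hc))
      _ = ENNReal.ofReal ((s.card : ℝ) * (2 * Real.exp (-(b * m)))) := by
        rw [← ENNReal.ofReal_add (by positivity) (by positivity), ← two_mul, Finset.sum_const,
          nsmul_eq_mul, ENNReal.ofReal_mul (p := (s.card : ℝ)) (by positivity), ENNReal.ofReal_natCast]
      _ ≤ _ := by
        apply ENNReal.ofReal_le_ofReal
        have h1 : (s.card : ℝ) * 2 ≤ M ^ n := by
          rw [hM, mul_pow]
          have : (2:ℝ) ≤ 2^n := by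
            calc (2:ℝ) = 2^1 := by norm_num
              _ ≤ 2^n := by gcongr; norm_num
          have h0 : 0 ≤ (s.card : ℝ) := by positivity
          have : (s.card : ℝ) * 2 ≤ (1 + 2/d)^n * 2^n := by gcongr
          linarith
        have h2 : M ^ n ≤ Real.exp (b/2 * m) := by
          have : M ^ n = Real.exp (n * Real.log M) := by
            rw [Real.exp_nat_mul, Real.exp_log (by linarith)]
          rw [this]
          apply Real.exp_le_exp.2
          rw [div_mul_eq_mul_div, div_le_iff₀ hb0] at hm
          linarith
        calc (s.card : ℝ) * (2 * Real.exp (-(b * m))) = (s.card : ℝ) * 2 * Real.exp (-(b*m)) := by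
              ring
          _ ≤ Real.exp (b/2*m) * Real.exp (-(b*m)) := by gcongr; exact h1.trans h2
          _ = _ := by rw [← Real.exp_add]; congr 1; ring
  have h1 : 1 ≤ sampleMeasure m n G + sampleMeasure m n Gᶜ := by
    rw [← measure_univ (μ := sampleMeasure m n), ← Set.union_compl_self G]
    exact measure_union_le _ _
  rw [ENNReal.ofReal_sub _ (by positivity), ENNReal.ofReal_one]
  rw [tsub_le_iff_right]
  exact h1.trans (by gcongr)

lemma rwc_theta (τ : ℝ) (hτ : 2 ≤ τ) :
    1/4 ≤ ∫ t in {s : ℝ | |s| ≤ τ}, t^2 ∂(gaussianReal 0 1) := by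
  have hS : {s : ℝ | |s| ≤ τ} = Set.Icc (-τ) τ := by
    ext s; simp [abs_le]
  rw [hS, gaussianReal_of_var_ne_zero _ one_ne_zero,
    setIntegral_withDensity_eq_setIntegral_toReal_smul (measurable_gaussianPDF 0 1)
      (Filter.Eventually.of_forall fun t => by simp [gaussianPDF]) _ measurableSet_Icc]
  have hpt : ∀ t : ℝ, (gaussianPDF 0 1 t).toReal • t^2 =
      (√(2 * Real.pi))⁻¹ * Real.exp (-(t^2/2)) * t^2 := by
    intro t
    rw [toReal_gaussianPDF, gaussianPDFReal, smul_eq_mul]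
    simp [neg_div]
  simp_rw [hpt]
  have hint : ∀ r : ℝ, IntegrableOn (fun t : ℝ => (√(2 * Real.pi))⁻¹ * Real.exp (-(t^2/2)) * t^2)
      (Set.Icc (-r) r) volume := fun r =>
    (Continuous.continuousOn (by fun_prop)).integrableOn_Icc
  have h1 : ∫ t in Set.Icc (-2 : ℝ) 2, (√(2 * Real.pi))⁻¹ * Real.exp (-(t^2/2)) * t^2 ≤
      ∫ t in Set.Icc (-τ) τ, (√(2 * Real.pi))⁻¹ * Real.exp (-(t^2/2)) * t^2 := by
    apply setIntegral_mono_set (hint τ)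
    · exact Filter.Eventually.of_forall fun t => by positivity
    · exact Filter.Eventually.of_forall fun t (ht : t ∈ Set.Icc (-2:ℝ) 2) =>
        (Set.Icc_subset_Icc (by linarith) hτ ht)
  refine le_trans ?_ h1
  have hpi : (1/3 : ℝ) ≤ (√(2 * Real.pi))⁻¹ := by
    rw [one_div]
    apply inv_anti₀ (by positivity)
    rw [Real.sqrt_le_iff]
    have := Real.pi_lt_d2
    constructor <;> norm_num; linarith
  have h2 : ∫ t in Set.Icc (-2 : ℝ) 2, (1/9 * (2 * t^2 - t^4/2)) ≤
      ∫ t in Set.Icc (-2 : ℝ) 2, (√(2 * Real.pi))⁻¹ * Real.exp (-(t^2/2)) * t^2 := by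
    apply setIntegral_mono_on (Continuous.continuousOn (by fun_prop)).integrableOn_Icc (hint 2)
      measurableSet_Icc
    intro t ht
    have ht2 : t^2 ≤ 4 := by nlinarith [ht.1, ht.2]
    have he : 1/3 * (2 - t^2/2) ≤ Real.exp (-(t^2/2)) := by
      have := Real.add_one_le_exp (1 - t^2/2)
      have e : Real.exp (-(t^2/2)) = Real.exp (1 - t^2/2) * Real.exp (-1) := by
        rw [← Real.exp_add]; congr 1; ring
      have h3 := Real.exp_neg_one_gt_d9
      rw [e]
      have h4 : 0 ≤ 2 - t^2/2 := by linarith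
      nlinarith
    have : 1/3 * (1/3 * (2 - t^2/2)) ≤ (√(2 * Real.pi))⁻¹ * Real.exp (-(t^2/2)) :=
      mul_le_mul hpi he (by linarith) (by positivity)
    have := mul_le_mul_of_nonneg_right this (sq_nonneg t)
    linarith
  refine le_trans ?_ h2
  rw [integral_Icc_eq_integral_Ioc, ← intervalIntegral.integral_of_le (by norm_num)]
  rw [intervalIntegral.integral_const_mul, intervalIntegral.integral_sub
    (Continuous.intervalIntegrable (by fun_prop) _ _)
    (Continuous.intervalIntegrable (by fun_prop) _ _), intervalIntegral.integral_const_mul,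
    intervalIntegral.integral_div]
  simp only [integral_pow]
  norm_num

lemma rwc_vecNorm_sq {n : ℕ} (v : Fin n → ℝ) : vecNorm v ^ 2 = ∑ i, (v i)^2 :=
  Real.sq_sqrt (Finset.sum_nonneg fun i _ => sq_nonneg _)

lemma rwc_frobNorm_sq {n : ℕ} (A : Matrix (Fin n) (Fin n) ℝ) :
    frobNorm A ^ 2 = ∑ i, ∑ j, (A i j)^2 :=
  Real.sq_sqrt (Finset.sum_nonneg fun i _ => Finset.sum_nonneg fun j _ => sq_nonneg _)

lemma rwc_frobNorm_nonneg {n : ℕ} (A : Matrix (Fin n) (Fin n) ℝ) : 0 ≤ frobNorm A :=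
  Real.sqrt_nonneg _

/-- Double sum of a product. -/
lemma rwc_sum_mul {n : ℕ} (p q : Fin n → ℝ) : ∑ i, ∑ j, p i * q j = (∑ i, p i) * ∑ j, q j := by
  rw [Finset.sum_mul_sum]

lemma rwc_frob_diff {n : ℕ} (z x : Fin n → ℝ) :
    frobNorm (vecMulVec z z - vecMulVec x x) ^ 2 =
      (vecNorm z ^ 2)^2 + (vecNorm x ^ 2)^2 - 2 * (dotp z x)^2 := by
  rw [rwc_frobNorm_sq, rwc_vecNorm_sq, rwc_vecNorm_sq, dotp, sq, sq (∑ i, x i ^ 2),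
    sq (∑ i, z i * x i), ← rwc_sum_mul, ← rwc_sum_mul, ← rwc_sum_mul]
  simp only [Finset.mul_sum, ← Finset.sum_add_distrib, ← Finset.sum_sub_distrib]
  refine Finset.sum_congr rfl fun i _ => Finset.sum_congr rfl fun j _ => ?_
  simp only [Matrix.sub_apply, vecMulVec_apply]; ring

lemma rwc_frob_self {n : ℕ} (x : Fin n → ℝ) : frobNorm (vecMulVec x x) = vecNorm x ^ 2 := by
  have h : frobNorm (vecMulVec x x) ^ 2 = (vecNorm x ^ 2)^2 := by
    rw [rwc_frobNorm_sq, rwc_vecNorm_sq, sq (∑ i, x i ^ 2), ← rwc_sum_mul]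
    refine Finset.sum_congr rfl fun i _ => Finset.sum_congr rfl fun j _ => ?_
    simp only [vecMulVec_apply]; ring
  exact (pow_left_inj₀ (rwc_frobNorm_nonneg _) (by positivity) two_ne_zero).1 h

/-- Component of `x` orthogonal to `z`. -/
noncomputable def rwcU {n : ℕ} (z x : Fin n → ℝ) : Fin n → ℝ :=
  x - ((vecNorm z ^ 2)⁻¹ * dotp z x) • z

lemma rwc_proj_perp {n : ℕ} (z x : Fin n → ℝ) (hz : vecNorm z ≠ 0) :
    (vecMulVec z z - vecMulVec x x) - projT z (vecMulVec z z - vecMulVec x x) =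
      - vecMulVec (rwcU z x) (rwcU z x) := by
  have hzz : z ⬝ᵥ z = vecNorm z ^ 2 := by
    rw [rwc_vecNorm_sq]; exact Finset.sum_congr rfl fun i _ => by ring
  have hzx : z ⬝ᵥ x = dotp z x := rfl
  have hxz : x ⬝ᵥ z = dotp z x := by rw [dotProduct_comm]; rfl
  unfold projT
  simp only [mul_sub, sub_mul, smul_mul_assoc, mul_smul_comm, vecMulVec_mul_vecMulVec, hzz, hzx, hxz,
    rwcU, smul_dotProduct]
  ext i j
  simp only [Matrix.sub_apply, Matrix.add_apply, Matrix.neg_apply, Matrix.smul_apply,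
    vecMulVec_apply, Pi.smul_apply, Pi.sub_apply, smul_eq_mul, vecMulVec_mul_vecMulVec, hzz, hzx, hxz,
    dotProduct_smul, vecMulVec_smul]
  field_simp
  ring

lemma rwc_u_norm {n : ℕ} (z x : Fin n → ℝ) (hz : vecNorm z ≠ 0) :
    vecNorm (rwcU z x) ^ 2 = vecNorm x ^ 2 - (dotp z x)^2 / vecNorm z ^ 2 := by
  set q := (vecNorm z ^ 2)⁻¹ * dotp z x with hq
  have h : vecNorm (rwcU z x) ^ 2 = vecNorm x ^ 2 - 2 * q * dotp z x + q^2 * vecNorm z ^ 2 := by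
    rw [rwc_vecNorm_sq, rwc_vecNorm_sq, rwc_vecNorm_sq, dotp]
    simp only [Finset.mul_sum, ← Finset.sum_add_distrib, ← Finset.sum_sub_distrib]
    refine Finset.sum_congr rfl fun i _ => ?_
    simp only [rwcU, Pi.sub_apply, Pi.smul_apply, smul_eq_mul, ← hq]; ring
  rw [h, hq]; field_simp; ring

lemma rwc_u_bound {n : ℕ} (z x : Fin n → ℝ) (hz : vecNorm z ≠ 0) :
    vecNorm (rwcU z x) ^ 2 * vecNorm x ^ 2 ≤ frobNorm (vecMulVec z z - vecMulVec x x) ^ 2 := by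
  rw [rwc_frob_diff]
  have h := rwc_u_norm z x hz
  have hz2 : 0 < vecNorm z ^ 2 := by positivity
  set β := (dotp z x)^2 / vecNorm z ^ 2 with hβ
  have hβ0 : 0 ≤ β := by positivity
  have e : (dotp z x)^2 = β * vecNorm z ^ 2 := by rw [hβ]; field_simp
  rw [e]
  have hu := sq_nonneg (vecNorm (rwcU z x))
  have hx : vecNorm x ^ 2 = vecNorm (rwcU z x) ^ 2 + β := by linarith
  rw [hx]
  nlinarith [sq_nonneg (vecNorm z ^ 2 - β), mul_nonneg hu hβ0]

lemma rwc_cs {n : ℕ} (v w : Fin n → ℝ) : |dotp v w| ≤ vecNorm v * vecNorm w := by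
  apply abs_le_of_sq_le_sq
  · rw [mul_pow, rwc_vecNorm_sq, rwc_vecNorm_sq]
    exact Finset.sum_mul_sq_le_sq_mul_sq _ _ _
  · exact mul_nonneg (rwc_vecNorm_nonneg _) (rwc_vecNorm_nonneg _)

lemma rwc_frob_proj {n : ℕ} (z : Fin n → ℝ) (hz : vecNorm z ≠ 0) (Y : Matrix (Fin n) (Fin n) ℝ)
    (hY : Yᵀ = Y) :
    frobNorm (projT z Y) ^ 2 ≤ 2 * (vecNorm z ^ 2)⁻¹ * vecNorm (Y *ᵥ z) ^ 2 := by
  set p := Y *ᵥ z with hp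
  set q := (vecNorm z ^ 2)⁻¹ with hq
  have hzY : z ᵥ* Y = p := by rw [hp, ← mulVec_transpose, hY]
  have hent : ∀ i j, projT z Y i j = q * (z i * p j) + q * (p i * z j)
      - q^2 * dotp z p * (z i * z j) := by
    intro i j
    unfold projT
    simp only [smul_mul_assoc, mul_smul_comm, vecMulVec_mul, mul_vecMulVec, hzY, ← hp, ← hq,
      vecMulVec_mul_vecMulVec]
    simp only [Matrix.sub_apply, Matrix.add_apply, Matrix.smul_apply,
      vecMulVec_apply, Pi.smul_apply, smul_eq_mul, vecMul_vecMulVec]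
    have : p ⬝ᵥ z = dotp z p := by rw [dotProduct_comm]; rfl
    have h2 : (vecMulVec z p *ᵥ z) i = dotp z p * z i := by
      rw [vecMulVec_mulVec]
      simp only [Pi.smul_apply, MulOpposite.smul_eq_mul_unop, MulOpposite.unop_op, this]
      ring
    rw [h2]; ring
  have hsum : frobNorm (projT z Y) ^ 2 = 2 * q^2 * (vecNorm z ^2 * vecNorm p ^ 2)
      + 2 * q^2 * (dotp z p * dotp z p) + (q^2 * dotp z p)^2 * (vecNorm z ^ 2 * vecNorm z ^ 2)
      - 4 * q * (q^2 * dotp z p) * (vecNorm z ^ 2 * dotp z p) := by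
    rw [rwc_frobNorm_sq]
    simp_rw [hent]
    generalize q^2 * dotp z p = r
    rw [rwc_vecNorm_sq, rwc_vecNorm_sq, dotp, ← rwc_sum_mul, ← rwc_sum_mul, ← rwc_sum_mul]
    have hsym : 4 * q * r * ((∑ i, z i ^ 2) * ∑ i, z i * p i) =
        2 * q * r * ∑ i, ∑ j, z i ^ 2 * (z j * p j) +
        2 * q * r * ∑ i, ∑ j, (z i * p i) * z j ^ 2 := by
      rw [rwc_sum_mul, rwc_sum_mul]; ring
    have hsym2 : 2 * q^2 * ∑ i, ∑ j, z i ^ 2 * p j ^ 2 =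
        q^2 * ∑ i, ∑ j, z i ^ 2 * p j ^ 2 + q^2 * ∑ i, ∑ j, p i ^ 2 * z j ^ 2 := by
      rw [rwc_sum_mul, rwc_sum_mul]; ring
    rw [hsym, hsym2]
    simp only [Finset.mul_sum, ← Finset.sum_add_distrib, ← Finset.sum_sub_distrib]
    refine Finset.sum_congr rfl fun i _ => Finset.sum_congr rfl fun j _ => ?_
    ring
  have hz2 : vecNorm z ^ 2 = q⁻¹ := by rw [hq, inv_inv]
  have hq0 : 0 < q := by rw [hq]; positivity
  rw [hsum, hz2]
  have : 2 * q^2 * (q⁻¹ * vecNorm p ^ 2)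
      + 2 * q^2 * (dotp z p * dotp z p) + (q^2 * dotp z p)^2 * (q⁻¹ * q⁻¹)
      - 4 * q * (q^2 * dotp z p) * (q⁻¹ * dotp z p) = 2 * q * vecNorm p ^ 2 - (q * dotp z p)^2 := by
    field_simp; ring
  rw [this]
  nlinarith [sq_nonneg (q * dotp z p)]

lemma rwc_frobInner {n : ℕ} (a u : Fin n → ℝ) :
    frobInner (vecMulVec a a) (- vecMulVec u u) = - (dotp a u)^2 := by
  rw [frobInner, dotp, sq, ← rwc_sum_mul, ← Finset.sum_neg_distrib]
  refine Finset.sum_congr rfl fun i _ => ?_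
  rw [← Finset.sum_neg_distrib]
  refine Finset.sum_congr rfl fun j _ => ?_
  simp only [vecMulVec_apply, Matrix.neg_apply]; ring

/-- Bound on the projected weighted sum of rank-one matrices. -/
lemma rwc_main_bound {n m : ℕ} (a : Fin m → Fin n → ℝ) (z : Fin n → ℝ) (hz : vecNorm z ≠ 0)
    (τ : ℝ) (b : Fin m → ℝ) (hτ : ∀ k, b k ≠ 0 → |dotp (a k) z| ≤ τ * vecNorm z)
    (hop : ∀ v, ∑ k, (dotp (a k) v)^2 ≤ 5/2 * m * (vecNorm v)^2) :
    frobNorm (projT z (∑ k, b k • vecMulVec (a k) (a k))) ^ 2 ≤ 5 * m * τ^2 * ∑ k, (b k)^2 := by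
  set Y := ∑ k, b k • vecMulVec (a k) (a k) with hYdef
  have hY : Yᵀ = Y := by
    rw [hYdef, Matrix.transpose_sum]
    refine Finset.sum_congr rfl fun k _ => ?_
    ext i j; simp [vecMulVec_apply, mul_comm]
  have h1 := rwc_frob_proj z hz Y hY
  set p := Y *ᵥ z with hp
  have hpi : ∀ i, p i = ∑ k, b k * dotp (a k) z * a k i := by
    intro i
    rw [hp, hYdef, Matrix.sum_mulVec, Finset.sum_apply]
    refine Finset.sum_congr rfl fun k _ => ?_
    rw [Matrix.smul_mulVec, vecMulVec_mulVec]
    simp only [Pi.smul_apply, smul_eq_mul, MulOpposite.smul_eq_mul_unop, MulOpposite.unop_op]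
    change b k * (a k i * dotp (a k) z) = _
    ring
  have hpp : vecNorm p ^ 2 = ∑ k, b k * (dotp (a k) z * dotp (a k) p) := by
    rw [rwc_vecNorm_sq]
    calc ∑ i, p i ^ 2 = ∑ i, ∑ k, b k * dotp (a k) z * (a k i * p i) := by
          refine Finset.sum_congr rfl fun i _ => ?_
          rw [sq]; nth_rewrite 1 [hpi i]
          rw [Finset.sum_mul]; exact Finset.sum_congr rfl fun k _ => by ring
      _ = ∑ k, ∑ i, b k * dotp (a k) z * (a k i * p i) := Finset.sum_comm
      _ = _ := by
          refine Finset.sum_congr rfl fun k _ => ?_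
          rw [← Finset.mul_sum, mul_assoc]; rfl
  set S := ∑ k, (b k)^2 with hS
  have hS0 : 0 ≤ S := Finset.sum_nonneg fun k _ => sq_nonneg _
  have hpp' : vecNorm p ^ 2 = ∑ k, b k * (if b k = 0 then 0 else dotp (a k) z * dotp (a k) p) := by
    rw [hpp]; refine Finset.sum_congr rfl fun k _ => ?_
    by_cases hb : b k = 0 <;> simp [hb]
  have hcs : (vecNorm p ^ 2)^2 ≤ S * ∑ k, (if b k = 0 then 0 else dotp (a k) z * dotp (a k) p)^2 := by
    rw [hpp']; exact Finset.sum_mul_sq_le_sq_mul_sq _ _ _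
  have h2 : ∑ k, (if b k = 0 then 0 else dotp (a k) z * dotp (a k) p)^2 ≤
      (τ * vecNorm z)^2 * ∑ k, (dotp (a k) p)^2 := by
    rw [Finset.mul_sum]
    refine Finset.sum_le_sum fun k _ => ?_
    by_cases hb : b k = 0
    · rw [if_pos hb, zero_pow two_ne_zero]; positivity
    · rw [if_neg hb, mul_pow]
      have hh : dotp (a k) z ^ 2 ≤ (τ * vecNorm z)^2 := by
        rw [← sq_abs (dotp (a k) z)]
        exact pow_le_pow_left₀ (abs_nonneg _) (hτ k hb) 2
      exact mul_le_mul_of_nonneg_right hh (sq_nonneg _)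
  have h3 := hop p
  have h4 : (vecNorm p ^ 2)^2 ≤ (S * ((τ * vecNorm z)^2 * (5/2 * m))) * vecNorm p ^ 2 := by
    refine hcs.trans ?_
    rw [mul_assoc, mul_assoc]
    gcongr
    exact h2.trans (by gcongr)
  have h5 : vecNorm p ^ 2 ≤ S * ((τ * vecNorm z)^2 * (5/2 * m)) := by
    rcases (sq_nonneg (vecNorm p)).eq_or_lt with h | h
    · rw [← h]; positivity
    · rw [sq (vecNorm p ^ 2)] at h4
      exact le_of_mul_le_mul_right h4 h
  refine h1.trans ?_
  calc 2 * (vecNorm z ^ 2)⁻¹ * vecNorm p ^ 2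
      ≤ 2 * (vecNorm z ^ 2)⁻¹ * (S * ((τ * vecNorm z)^2 * (5/2 * m))) := by gcongr
    _ = _ := by field_simp

lemma rwc_phi_lower (R R₀ t : ℝ) (h0 : 0 < R₀) (h : R₀ ≤ R) (ht : |t| ≤ R) :
    t^4 ≤ R^2 * rwcPhi R₀ t := by
  unfold rwcPhi
  have ht2 : t^2 ≤ R^2 := by rw [← sq_abs]; gcongr
  rcases le_total (t^2/R₀^2) 1 with h1 | h1
  · rw [min_eq_left h1]
    have : 1 ≤ R^2 / R₀^2 := by rw [one_le_div (by positivity)]; gcongr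
    have e : R^2 * (t^2 * (t^2/R₀^2)) = (R^2/R₀^2) * t^4 := by ring
    rw [e]; nlinarith [show 0 ≤ t^4 by positivity]
  · rw [min_eq_right h1]; nlinarith [sq_nonneg t]

lemma rwc_S4 {n m : ℕ} (a : Fin m → Fin n → ℝ) (u : Fin n → ℝ) (D ε₀ X : ℝ) (hD : 0 < D)
    (hε₀ : 0 < ε₀) (hX : 0 < X) (hu : vecNorm u ≤ ε₀ * X) (P : Fin m → Prop)
    (hP : ∀ k, P k → |dotp (a k) u| ≤ D * X)
    (hphi : ∀ v, vecNorm v ≤ 1 → ∑ k, rwcPhi (D / ε₀) (dotp (a k) v) ≤ 25 / (D/ε₀)^2 * m) :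
    ∑ k, (if P k then (dotp (a k) u)^4 else 0) ≤ 25 * ε₀^2 * m * (vecNorm u ^ 2 * X^2) := by
  by_cases hu0 : u = 0
  · subst hu0
    have : ∀ k, (if P k then (dotp (a k) (0 : Fin n → ℝ))^4 else 0) = 0 := by
      intro k; simp [dotp]
    simp only [this, Finset.sum_const_zero]; positivity
  have hpos : 0 < vecNorm u := lt_of_le_of_ne (rwc_vecNorm_nonneg u)
      (Ne.symm ((rwc_vecNorm_eq_zero u).not.2 hu0))
  set r := vecNorm u with hr
  set v := r⁻¹ • u with hv
  have hv1 : vecNorm v ≤ 1 := by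
    rw [hv, rwc_vecNorm_smul, abs_of_pos (inv_pos.2 hpos), ← hr, inv_mul_cancel₀ hpos.ne']
  have hdv : ∀ k, dotp (a k) u = r * dotp (a k) v := by
    intro k; rw [hv, rwc_dotp_smul]; field_simp
  have h1 : ∑ k, (if P k then (dotp (a k) u)^4 else 0) ≤
      r^4 * (D * X / r)^2 * ∑ k, rwcPhi (D/ε₀) (dotp (a k) v) := by
    rw [Finset.mul_sum]
    refine Finset.sum_le_sum fun k _ => ?_
    by_cases hk : P k
    · simp only [hk, if_true]
      rw [hdv k, mul_pow, mul_assoc]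
      gcongr
      apply rwc_phi_lower _ _ _ (by positivity)
      · rw [div_le_div_iff₀ hε₀ hpos]
        nlinarith
      · have := hP k hk
        rw [hdv k, abs_mul, abs_of_pos hpos] at this
        rw [le_div_iff₀ hpos]; linarith
    · simp only [hk, if_false]
      rw [rwc_phi_eq _ _ (by positivity)]; positivity
  refine h1.trans ?_
  calc _ ≤ r^4 * (D * X / r)^2 * (25 / (D/ε₀)^2 * m) := by gcongr; exact hphi v hv1
    _ = _ := by field_simp

lemma rwc_le_of_sq {p q : ℝ} (hq : 0 ≤ q) (h : p^2 ≤ q^2) : p ≤ q :=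
  le_of_abs_le (abs_le_of_sq_le_sq h hq)

/-- Restricted weak correlation property of the truncated sensing operator. -/
theorem restricted_weak_correlation
    (τz τh τx : ℝ) (hτz : 2 ≤ τz) (hτh : 1 ≤ τh) (hτx : 1 ≤ τx)
    (ρ₃ : ℝ) (hρ₃ : 0 < ρ₃)
    (τhz : ℝ) (hτhz : τhz = τz + Real.sqrt (0.3 * τh * (τz + 1.2 * τx) + τz^2))
    (ε₀ : ℝ) (hε₀pos : 0 < ε₀)
    (hε₀ : ε₀ ≤ (1/2) * min (Real.sqrt (ρ₃ / (3 * (τz^4 + 5*τz^3 + 8*τz^2 + 2*τh^2))))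
        (min (ρ₃ / (15 * τz * τhz)) (1/11)))
    (ϑ₁ ϑ₂ : ℝ)
    (hϑ₁ : ϑ₁ = (∫ t in {s : ℝ | |s| ≤ τz}, t^4 ∂(gaussianReal 0 1))
      - ∫ t in {s : ℝ | |s| ≤ τz}, t^2 ∂(gaussianReal 0 1))
    (hϑ₂ : ϑ₂ = ∫ t in {s : ℝ | |s| ≤ τz}, t^2 ∂(gaussianReal 0 1)) :
    ∀ ε : ℝ, ε ∈ Set.Ioo (0:ℝ) 1 →
    ∃ c C : ℝ, 0 < c ∧ 0 < C ∧
      ∀ (n : ℕ) (x : Fin n → ℝ), x ≠ 0 →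
      ∀ m : ℕ, C * (n : ℝ) ≤ (m : ℝ) →
      sampleMeasure m n {a : Fin m → Fin n → ℝ |
        ∀ z : Fin n → ℝ,
          frobNorm (vecMulVec z z - vecMulVec x x) ≤ ε₀ * frobNorm (vecMulVec x x) →
          (1 / (m : ℝ)) * frobNorm (projT z (truncAdj a x τx τz τh z
              (truncOp a x τx τz τh z
                ((vecMulVec z z - vecMulVec x x)
                  - projT z (vecMulVec z z - vecMulVec x x)))))
            ≤ Real.sqrt ((ρ₃ + 6 * τh * τhz^2 * Real.exp (-(0.64 * τh^2)) + ε)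
                * (max (ϑ₁ + ϑ₂ + (10 * τz^3 * Real.exp (-(0.49 * τz^2)) + ε))
                      (2 * (ϑ₂ + (10 * τz^3 * Real.exp (-(0.49 * τz^2)) + ε)))))
              * frobNorm (vecMulVec z z - vecMulVec x x)}
        ≥ ENNReal.ofReal (1 - Real.exp (-(c * (m : ℝ)))) := by
  intro ε hε
  have hD : 0 < 2 * τx + τz := by linarith
  have hε1 : ε₀ ≤ 1/22 := by
    have h1 := min_le_right (Real.sqrt (ρ₃ / (3 * (τz^4 + 5*τz^3 + 8*τz^2 + 2*τh^2))))
        (min (ρ₃ / (15 * τz * τhz)) (1/11))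
    have h2 := min_le_right (ρ₃ / (15 * τz * τhz)) (1/11 : ℝ)
    linarith
  have hε2 : 264 * τz^2 * ε₀^2 ≤ ρ₃ := by
    have h1 := min_le_left (Real.sqrt (ρ₃ / (3 * (τz^4 + 5*τz^3 + 8*τz^2 + 2*τh^2))))
        (min (ρ₃ / (15 * τz * τhz)) (1/11))
    set q := τz^4 + 5*τz^3 + 8*τz^2 + 2*τh^2 with hq
    have hq0 : 0 < q := by positivity
    have h2 : 2 * ε₀ ≤ Real.sqrt (ρ₃ / (3 * q)) := by linarith
    have h3 : (2 * ε₀)^2 ≤ ρ₃ / (3 * q) := by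
      have h := pow_le_pow_left₀ (by positivity) h2 2
      rwa [Real.sq_sqrt (by positivity)] at h
    rw [le_div_iff₀ (by positivity)] at h3
    have hq1 : 22 * τz^2 ≤ q := by
      have : 14 ≤ τz^2 + 5 * τz := by nlinarith
      have := mul_le_mul_of_nonneg_left this (sq_nonneg τz)
      rw [hq]; nlinarith [sq_nonneg τh]
    nlinarith [mul_le_mul_of_nonneg_left hq1 (sq_nonneg ε₀)]
  have hR : 3 ≤ (2 * τx + τz) / ε₀ := by
    rw [le_div_iff₀ hε₀pos]; linarith
  obtain ⟨c, C, hc, hC, hev⟩ := rwc_event _ hR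
  refine ⟨c, C, hc, hC, ?_⟩
  intro n x hx m hm
  have hn : 1 ≤ n := by
    rcases Nat.eq_zero_or_pos n with h | h
    · subst h; exact absurd (Subsingleton.elim x 0) hx
    · exact h
  have hm0 : 0 < (m : ℝ) := by
    have : (0:ℝ) < n := by exact_mod_cast hn
    have : 0 < C * n := by positivity
    linarith
  refine ge_iff_le.2 ((hev n m hn hm).trans (measure_mono ?_))
  rintro a ⟨hop, hphi⟩ z hzx
  have hX : 0 < vecNorm x := lt_of_le_of_ne (rwc_vecNorm_nonneg x)
      (Ne.symm ((rwc_vecNorm_eq_zero x).not.2 hx))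
  rw [rwc_frob_self] at hzx
  set w := frobNorm (vecMulVec z z - vecMulVec x x) with hw
  have hw0 : 0 ≤ w := rwc_frobNorm_nonneg _
  have hz : vecNorm z ≠ 0 := by
    intro h
    have hd := rwc_frob_diff z x
    rw [(rwc_vecNorm_eq_zero z).1 h] at hd
    have e0 : dotp (0 : Fin n → ℝ) x = 0 := by simp [dotp]
    have e1 : vecNorm (0 : Fin n → ℝ) = 0 := (rwc_vecNorm_eq_zero _).2 rfl
    rw [e0, e1, ← (rwc_vecNorm_eq_zero z).1 h, ← hw] at hd
    have hw2 : w = vecNorm x ^ 2 :=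
      (pow_left_inj₀ hw0 (by positivity) two_ne_zero).1 (by rw [hd]; ring)
    have hx2 : 0 < vecNorm x ^ 2 := by positivity
    nlinarith
  have hzpos : 0 < vecNorm z := lt_of_le_of_ne (rwc_vecNorm_nonneg z) (Ne.symm hz)
  rw [rwc_proj_perp z x hz]
  set u := rwcU z x with hu
  have hub : vecNorm u ^ 2 * vecNorm x ^ 2 ≤ w^2 := rwc_u_bound z x hz
  have huX : vecNorm u ≤ ε₀ * vecNorm x := by
    have h1 : vecNorm u * vecNorm x ≤ w := by
      apply rwc_le_of_sq hw0; rw [mul_pow]; exact hub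
    have h2 : vecNorm u * vecNorm x ≤ (ε₀ * vecNorm x) * vecNorm x := by
      refine (h1.trans hzx).trans_eq (by ring)
    exact le_of_mul_le_mul_right h2 hX
  have hP : ∀ k, truncEvent a x τx τz τh z k → |dotp (a k) u| ≤ (2 * τx + τz) * vecNorm x := by
    rintro k ⟨h1, h2, -⟩
    rw [Real.sqrt_sq_eq_abs] at h1
    have h3 : Real.sqrt ((∑ j, (dotp (a j) x)^2) / (m : ℝ)) ≤ 2 * vecNorm x := by
      rw [Real.sqrt_le_iff]
      refine ⟨by positivity, ?_⟩
      rw [div_le_iff₀ hm0]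
      have := hop x
      nlinarith [mul_pos hm0 (pow_pos hX 2)]
    have h4 : |dotp (a k) x| ≤ τx * (2 * vecNorm x) := h1.trans (by gcongr)
    have h5 : |(vecNorm z ^ 2)⁻¹ * dotp z x * dotp (a k) z| ≤ τz * vecNorm x := by
      rw [abs_mul, abs_mul, abs_of_pos (by positivity)]
      calc (vecNorm z ^ 2)⁻¹ * |dotp z x| * |dotp (a k) z|
          ≤ (vecNorm z ^ 2)⁻¹ * (vecNorm z * vecNorm x) * (τz * vecNorm z) := by
            gcongr; exact rwc_cs z x
        _ = _ := by field_simp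
    rw [hu, rwcU, rwc_dotp_sub, rwc_dotp_smul]
    refine (abs_sub _ _).trans ?_
    linarith
  have hS4 := rwc_S4 a u _ ε₀ (vecNorm x) hD hε₀pos hX huX _ hP hphi
  set b : Fin m → ℝ := fun k => if truncEvent a x τx τz τh z k then -(dotp (a k) u)^2 else 0 with hb
  have hadj : truncAdj a x τx τz τh z (truncOp a x τx τz τh z (-vecMulVec u u)) =
      ∑ k, b k • vecMulVec (a k) (a k) := by
    unfold truncAdj truncOp
    refine Finset.sum_congr rfl fun k _ => ?_
    rw [rwc_frobInner]
    by_cases hk : truncEvent a x τx τz τh z k <;> simp [hb, hk]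
  have hbt : ∀ k, b k ≠ 0 → |dotp (a k) z| ≤ τz * vecNorm z := by
    intro k hk
    by_cases h : truncEvent a x τx τz τh z k
    · exact h.2.1
    · exact absurd (by simp [hb, h]) hk
  have hb2 : ∑ k, (b k)^2 = ∑ k, (if truncEvent a x τx τz τh z k then (dotp (a k) u)^4 else 0) := by
    refine Finset.sum_congr rfl fun k _ => ?_
    by_cases h : truncEvent a x τx τz τh z k
    · simp only [hb, h, if_true]; ring
    · simp [hb, h]
  have hmain := rwc_main_bound a z hz τz b hbt hop
  rw [hb2] at hmain
  rw [hadj]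
  set F := frobNorm (projT z (∑ k, b k • vecMulVec (a k) (a k))) with hF
  have hF0 : 0 ≤ F := rwc_frobNorm_nonneg _
  have hF2 : F^2 ≤ (125 * τz^2 * ε₀^2) * (m * w)^2 := by
    refine hmain.trans ?_
    calc _ ≤ 5 * m * τz^2 * (25 * ε₀^2 * m * (vecNorm u ^ 2 * vecNorm x ^2)) := by gcongr
      _ ≤ 5 * m * τz^2 * (25 * ε₀^2 * m * w^2) := by gcongr
      _ = _ := by ring
  set θ := max (ϑ₁ + ϑ₂ + (10 * τz^3 * Real.exp (-(0.49 * τz^2)) + ε))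
                      (2 * (ϑ₂ + (10 * τz^3 * Real.exp (-(0.49 * τz^2)) + ε))) with hθ
  have hθ1 : 1/2 ≤ θ := by
    refine le_trans ?_ (le_max_right _ _)
    have h1 := rwc_theta τz hτz
    rw [← hϑ₂] at h1
    have h2 : 0 ≤ 10 * τz^3 * Real.exp (-(0.49 * τz^2)) := by positivity
    linarith [hε.1]
  set ρ := ρ₃ + 6 * τh * τhz^2 * Real.exp (-(0.64 * τh^2)) + ε with hρ
  have hρ1 : ρ₃ ≤ ρ := by
    have : 0 ≤ 6 * τh * τhz^2 * Real.exp (-(0.64 * τh^2)) := by positivity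
    linarith [hε.1]
  have hfin : 125 * τz^2 * ε₀^2 ≤ ρ * θ := by
    have h1 : ρ₃ * (1/2) ≤ ρ * θ := mul_le_mul hρ1 hθ1 (by norm_num) (by linarith)
    have h2 : 0 ≤ τz^2 * ε₀^2 := by positivity
    linarith
  have hF3 : F ≤ Real.sqrt (ρ * θ) * (m * w) := by
    apply rwc_le_of_sq (by positivity)
    rw [mul_pow, Real.sq_sqrt (le_trans (by positivity) hfin)]
    exact hF2.trans (by gcongr)
  rw [one_div, inv_mul_le_iff₀ hm0]
  linarith
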